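/- arXiv:1608.02674 — 5 statements merged into one kernel-verified Lean document; each statement's English description precedes it below -/
import Mathlib

section
/- Let R be a commutative ring, let n ≥ 1, and let A be an n×n matrix over R. Write charpoly(A) = X^n + c_1·X^{n-1} + ... + c_{n-1}·X + c_n, i.e., c_i = coeff_{n-i}(charpoly(A)) for 1 ≤ i ≤ n, and set s_k = trace(A^k) for k ≥ 1. Then for every k with 1 ≤ k ≤ n: s_k + s_{k-1}·c_1 + s_{k-2}·c_2 + ... + s_1·c_{k-1} + k·c_k = 0. (Equivalently, S·c = −s, where S is the lower triangular matrix with S[k,k] = k and S[k,i] = s_{k-i} for i < k.) -/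
open Polynomial in
/-- The derivative of a determinant is the sum over the columns of the determinants in which that
column has been differentiated. -/
theorem derivative_det_eq_sum_det_updateCol {ι R : Type*} [Fintype ι] [DecidableEq ι] [CommRing R]
    (M : Matrix ι ι R[X]) :
    derivative M.det = ∑ i, (M.updateCol i fun k => derivative (M k i)).det := by
  simp only [Matrix.det_apply, derivative_sum, derivative_smul, derivative_prod_finset]
  rw [Finset.sum_comm]
  refine Finset.sum_congr rfl fun σ _ => ?_
  rw [← Finset.smul_sum]
  congr 1
  refine Finset.sum_congr rfl fun i _ => ?_
  rw [← Finset.prod_erase_mul _ _ (Finset.mem_univ i)]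
  congr 1
  · refine Finset.prod_congr rfl fun j hj => ?_
    rw [Matrix.updateCol_ne (Finset.ne_of_mem_erase hj)]
  · rw [Matrix.updateCol_self]

open Polynomial in
/-- The derivative of the characteristic polynomial is the trace of the adjugate of the
characteristic matrix. -/
theorem derivative_charpoly_eq_trace_adjugate {ι R : Type*} [Fintype ι] [DecidableEq ι]
    [CommRing R] (A : Matrix ι ι R) :
    derivative A.charpoly = A.charmatrix.adjugate.trace := by
  rw [Matrix.charpoly, derivative_det_eq_sum_det_updateCol, Matrix.trace]
  refine Finset.sum_congr rfl fun i _ => ?_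
  have hcol : (fun k => derivative (A.charmatrix k i)) = Pi.single i 1 := by
    ext1 k
    rcases eq_or_ne k i with rfl | hk
    · simp [Matrix.charmatrix_apply_eq]
    · simp [hk]
  rw [hcol, Matrix.diag_apply, ← Matrix.transpose_apply A.charmatrix.adjugate,
    Matrix.adjugate_transpose, Matrix.adjugate_apply, Matrix.updateRow_transpose,
    Matrix.det_transpose]

open Polynomial in
/-- One step of Horner's scheme for the coefficients of the adjugate of the characteristic
matrix. -/
theorem coeff_matPolyEquiv_adjugate_charmatrix {ι R : Type*} [Fintype ι] [DecidableEq ι]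
    [CommRing R] (A : Matrix ι ι R) (j : ℕ) :
    (matPolyEquiv A.charmatrix.adjugate).coeff j =
      A.charpoly.coeff (j + 1) • (1 : Matrix ι ι R) +
        A * (matPolyEquiv A.charmatrix.adjugate).coeff (j + 1) := by
  have h := congrArg (fun M => (matPolyEquiv M).coeff (j + 1)) (Matrix.mul_adjugate A.charmatrix)
  simp only [map_mul, Matrix.matPolyEquiv_charmatrix, sub_mul, coeff_sub, coeff_X_mul,
    coeff_C_mul] at h
  rw [sub_eq_iff_eq_add] at h
  rw [h, ← Matrix.charpoly, matPolyEquiv_smul_one, coeff_map, Algebra.algebraMap_eq_smul_one]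

open Polynomial in
theorem coeff_matPolyEquiv_adjugate_charmatrix_eq_sum_add {ι R : Type*} [Fintype ι]
    [DecidableEq ι] [CommRing R] (A : Matrix ι ι R) (j m : ℕ) :
    (matPolyEquiv A.charmatrix.adjugate).coeff j =
      ∑ i ∈ Finset.range m, A.charpoly.coeff (j + 1 + i) • A ^ i +
        A ^ m * (matPolyEquiv A.charmatrix.adjugate).coeff (j + m) := by
  induction m with
  | zero => simp
  | succ m ih =>
    rw [ih, coeff_matPolyEquiv_adjugate_charmatrix A (j + m), Finset.sum_range_succ, mul_add,
      ← mul_assoc, ← pow_succ, mul_smul_comm, mul_one, ← add_assoc, add_right_comm j 1 m,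
      ← add_assoc j m 1]

theorem coeff_charpoly_of_card_lt {ι R : Type*} [Fintype ι] [DecidableEq ι] [CommRing R]
    (A : Matrix ι ι R) {j : ℕ} (hj : Fintype.card ι < j) : A.charpoly.coeff j = 0 := by
  nontriviality R
  exact Polynomial.coeff_eq_zero_of_natDegree_lt (by rwa [Matrix.charpoly_natDegree_eq_dim])

open Polynomial in
theorem coeff_matPolyEquiv_adjugate_charmatrix_of_card_le {ι R : Type*} [Fintype ι]
    [DecidableEq ι] [CommRing R] (A : Matrix ι ι R) {j : ℕ} (hj : Fintype.card ι ≤ j) :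
    (matPolyEquiv A.charmatrix.adjugate).coeff j = 0 := by
  rw [coeff_matPolyEquiv_adjugate_charmatrix_eq_sum_add A j
      ((matPolyEquiv A.charmatrix.adjugate).natDegree + 1),
    coeff_eq_zero_of_natDegree_lt (n := j + _) (by omega), mul_zero, add_zero]
  refine Finset.sum_eq_zero fun i _ => ?_
  rw [coeff_charpoly_of_card_lt A (by omega), zero_smul]

open Polynomial in
/-- Newton's identities for the characteristic polynomial, including the zeroth power sum. -/
theorem sum_coeff_charpoly_mul_trace_pow {ι R : Type*} [Fintype ι] [DecidableEq ι] [CommRing R]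
    (A : Matrix ι ι R) {k j : ℕ} (h : j + k = Fintype.card ι) :
    ∑ i ∈ Finset.range (k + 1), A.charpoly.coeff (j + i) * (A ^ i).trace =
      (j : R) * A.charpoly.coeff j := by
  rcases j with _ | j
  · nontriviality R
    have hA := Matrix.aeval_self_charpoly A
    rw [aeval_eq_sum_range, Matrix.charpoly_natDegree_eq_dim, ← h, zero_add] at hA
    simpa [Matrix.trace_sum, Matrix.trace_smul] using congrArg Matrix.trace hA
  · have hd := congrArg (fun p => p.coeff j) (derivative_charpoly_eq_trace_adjugate A)
    have ht : A.charmatrix.adjugate.trace.coeff j =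
        ((matPolyEquiv A.charmatrix.adjugate).coeff j).trace := by
      simp [Matrix.trace]
    have hs := coeff_matPolyEquiv_adjugate_charmatrix_eq_sum_add A j (k + 1)
    rw [coeff_matPolyEquiv_adjugate_charmatrix_of_card_le A (j := j + (k + 1)) (by omega),
      mul_zero, add_zero] at hs
    simp only [ht, hs, coeff_derivative, Matrix.trace_sum, Matrix.trace_smul, smul_eq_mul] at hd
    rw [← hd, mul_comm]
    push_cast
    rfl

/-- Newton-type identities relating the power sums `s_k = trace (A^k)` and the
coefficients `c_i = coeff_{n-i} (charpoly A)` of the characteristic polynomial: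
for every `1 ≤ k ≤ n`, `s_k + s_{k-1}·c_1 + ⋯ + s_1·c_{k-1} + k·c_k = 0`. -/
theorem stmt0 (R : Type*) [CommRing R] (n : ℕ) (hn : 1 ≤ n)
    (A : Matrix (Fin n) (Fin n) R)
    (c : ℕ → R) (hc : ∀ i, 1 ≤ i → i ≤ n → c i = (Matrix.charpoly A).coeff (n - i))
    (s : ℕ → R) (hs : ∀ k, 1 ≤ k → s k = Matrix.trace (A ^ k)) :
    ∀ k, 1 ≤ k → k ≤ n →
      s k + (∑ i ∈ Finset.Ico 1 k, s (k - i) * c i) + (k : R) * c k = 0 := by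
  intro k hk hkn
  have hN := sum_coeff_charpoly_mul_trace_pow A (k := k) (j := n - k) (by simp; omega)
  obtain ⟨m, rfl⟩ : ∃ m, k = m + 1 := ⟨k - 1, by omega⟩
  have hlead : A.charpoly.coeff n = 1 := by
    nontriviality R
    simpa using (Matrix.charpoly_monic A).coeff_natDegree
  rw [Finset.sum_range_succ, Finset.sum_range_succ', ← hs _ hk, Nat.sub_add_cancel hkn, hlead,
    add_zero, pow_zero, Matrix.trace_one, Fintype.card_fin, ← hc _ hk hkn,
    Nat.cast_sub hkn] at hN
  have hsum : ∑ i ∈ Finset.range m, A.charpoly.coeff (n - (m + 1) + (i + 1)) *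
      (A ^ (i + 1)).trace = ∑ i ∈ Finset.Ico 1 (m + 1), s (m + 1 - i) * c i := by
    rw [Finset.sum_Ico_eq_sum_range, Nat.add_sub_cancel, ← Finset.sum_range_reflect]
    refine Finset.sum_congr rfl fun i hi => ?_
    have hi := Finset.mem_range.mp hi
    rw [hs _ (by omega), hc _ (by omega) (by omega), mul_comm]
    congr 3 <;> omega
  rw [hsum] at hN
  linear_combination hN
end

section
/- Let n ≥ 1, m ≥ 1 and M ≥ 0 be integers, let A be an n×m matrix and B an m×n matrix, both with integer entries satisfying |A[i,s]| ≤ M and |B[s,j]| ≤ M for all indices. For each (i,j) define the natural number c_{ij} = ∑_{s=1}^{m} (m+1)^{2M − A[i,s] − B[s,j]} (all exponents are nonnegative integers), and let μ_{ij} = min_{1 ≤ s ≤ m} (A[i,s] + B[s,j]). Then for all (i,j): (m+1)^{2M − μ_{ij}} ≤ c_{ij} < (m+1)^{2M − μ_{ij} + 1}. -/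
/-- Encoding of the distance product: if `A` is an `n × m` and `B` an `m × n` integer matrix
with all entries of absolute value at most `M`, and
`c_{ij} = ∑_s (m+1)^{2M - A[i,s] - B[s,j]}`, then with
`μ_{ij} = min_s (A[i,s] + B[s,j])` we have
`(m+1)^{2M - μ_{ij}} ≤ c_{ij} < (m+1)^{2M - μ_{ij} + 1}`. -/
theorem stmt5 (n m : ℕ) (hn : 1 ≤ n) (hm : 1 ≤ m) (M : ℕ)
    (A : Matrix (Fin n) (Fin m) ℤ) (B : Matrix (Fin m) (Fin n) ℤ)
    (hA : ∀ i s, |A i s| ≤ (M : ℤ)) (hB : ∀ s j, |B s j| ≤ (M : ℤ))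
    (i j : Fin n)
    (c : ℕ) (hc : c = ∑ s : Fin m, (m + 1) ^ (2 * (M : ℤ) - A i s - B s j).toNat)
    (μ : ℤ) (hμ : IsLeast {x : ℤ | ∃ s : Fin m, x = A i s + B s j} μ) :
    (m + 1) ^ (2 * (M : ℤ) - μ).toNat ≤ c ∧
      c < (m + 1) ^ ((2 * (M : ℤ) - μ).toNat + 1) := by
  obtain ⟨⟨t, ht⟩, hmin⟩ := hμ
  subst hc
  constructor
  · have h := Finset.single_le_sum
      (f := fun s : Fin m => (m + 1) ^ (2 * (M : ℤ) - A i s - B s j).toNat)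
      (fun s _ => Nat.zero_le _) (Finset.mem_univ t)
    rwa [ht, ← sub_sub]
  · calc ∑ s : Fin m, (m + 1) ^ (2 * (M : ℤ) - A i s - B s j).toNat
        ≤ ∑ _s : Fin m, (m + 1) ^ (2 * (M : ℤ) - μ).toNat := by
          refine Finset.sum_le_sum fun s _ => Nat.pow_le_pow_right m.succ_pos ?_
          have hs : μ ≤ A i s + B s j := hmin ⟨s, rfl⟩
          omega
      _ = (m + 1) ^ (2 * (M : ℤ) - μ).toNat * m := by simp [mul_comm]
      _ < (m + 1) ^ ((2 * (M : ℤ) - μ).toNat + 1) := by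
          rw [pow_succ]
          exact Nat.mul_lt_mul_of_pos_left m.lt_succ_self (by positivity)
end

section
/- Let n ≥ 1, m ≥ 1 and M ≥ 0 be integers, let A be an n×m matrix and B an m×n matrix, both with integer entries satisfying |A[i,s]| ≤ M and |B[s,j]| ≤ M for all indices. For each (i,j) define the natural number c_{ij} = ∑_{s=1}^{m} (m+1)^{2M − A[i,s] − B[s,j]}. Then for all (i,j) the (i,j) entry of the distance product satisfies min_{1 ≤ s ≤ m} (A[i,s] + B[s,j]) = 2M − ⌊log_{m+1} c_{ij}⌋, where ⌊log_{m+1} c⌋ denotes the natural-number logarithm (the largest e with (m+1)^e ≤ c). -/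
/-- If `E` is the largest of the exponents `e s`, then the sum of the powers `b ^ e s`, with fewer
than `b` terms, has `E` as its integer logarithm in base `b`. -/
theorem Nat.log_sum_pow_eq {ι : Type*} [Fintype ι] {b E : ℕ} (hb : Fintype.card ι < b)
    {e : ι → ℕ} (hle : ∀ s, e s ≤ E) {s₀ : ι} (hs₀ : e s₀ = E) :
    Nat.log b (∑ s, b ^ e s) = E := by
  have hb0 : 0 < b := by omega
  refine Nat.log_eq_of_pow_le_of_lt_pow ?_ ?_
  · rw [← hs₀]
    exact Finset.single_le_sum (f := fun s => b ^ e s) (fun _ _ => Nat.zero_le _)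
      (Finset.mem_univ s₀)
  · calc ∑ s, b ^ e s ≤ ∑ _s : ι, b ^ E :=
          Finset.sum_le_sum fun s _ => Nat.pow_le_pow_right hb0 (hle s)
      _ = Fintype.card ι * b ^ E := by simp
      _ < b * b ^ E := Nat.mul_lt_mul_of_pos_right hb (Nat.pow_pos hb0)
      _ = b ^ (E + 1) := (Nat.pow_succ').symm

/-- Recovering the distance product from the encoded matrix product: with
`c_{ij} = ∑_s (m+1)^{2M - A[i,s] - B[s,j]}` and entries bounded by `M` in absolute value,
the entry `min_s (A[i,s] + B[s,j])` of the distance product equals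
`2M - ⌊log_{m+1} c_{ij}⌋`. -/
theorem stmt6 (n m : ℕ) (hn : 1 ≤ n) (hm : 1 ≤ m) (M : ℕ)
    (A : Matrix (Fin n) (Fin m) ℤ) (B : Matrix (Fin m) (Fin n) ℤ)
    (hA : ∀ i s, |A i s| ≤ (M : ℤ)) (hB : ∀ s j, |B s j| ≤ (M : ℤ))
    (i j : Fin n)
    (c : ℕ) (hc : c = ∑ s : Fin m, (m + 1) ^ (2 * (M : ℤ) - A i s - B s j).toNat)
    (μ : ℤ) (hμ : IsLeast {x : ℤ | ∃ s : Fin m, x = A i s + B s j} μ) :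
    μ = 2 * (M : ℤ) - (Nat.log (m + 1) c : ℤ) := by
  obtain ⟨⟨s₀, rfl⟩, hmin⟩ := hμ
  have hle (s : Fin m) : A i s₀ + B s₀ j ≤ A i s + B s j := hmin ⟨s, rfl⟩
  have hlog := Nat.log_sum_pow_eq (b := m + 1) (by simp)
    (e := fun s : Fin m => (2 * (M : ℤ) - A i s - B s j).toNat)
    (fun s => Int.toNat_le_toNat (by linarith [hle s])) (s₀ := s₀) rfl
  have h₁ := (abs_le.mp (hA i s₀)).2
  have h₂ := (abs_le.mp (hB s₀ j)).2
  rw [hc, hlog, Int.toNat_of_nonneg (by linarith)]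
  ring
end

section
/- Let F be a finite field with q elements, let n ≥ 1, and let A be an n×n matrix over F. Call a pair (v, w) ∈ F^n × F^n bad if there exists a nonzero polynomial g over F with deg g < deg(minpoly F A) such that wᵀ·g(A)·A^j·v = 0 for every j ≥ 0. Then q·|Bad| ≤ 2n·q^{2n}, where Bad is the set of bad pairs. (Equivalently, if v and w are chosen uniformly at random from F^n, then with probability at least 1 − 2n/q no such g exists, i.e., the generating polynomial of the sequence (wᵀA^j v)_{j≥0} equals minpoly F A.) -/
open Polynomial in
/-- If `g` is nonzero of degree less than `m`, then some irreducible factor `p` of `m` has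
its cofactor in the ideal spanned by `g` and `m`. -/
lemma exists_mem_normalizedFactors_div_eq {F : Type*} [Field F] [DecidableEq F] {g m : F[X]}
    (hg : g ≠ 0) (hdeg : g.degree < m.degree) :
    ∃ p ∈ UniqueFactorizationMonoid.normalizedFactors m, ∃ a b : F[X],
      m / p = a * g + b * m := by
  classical
  have hm : m ≠ 0 := by
    rintro rfl
    simp at hdeg
  obtain ⟨c, hc⟩ := EuclideanDomain.gcd_dvd_right g m
  have hc0 : c ≠ 0 := by
    rintro rfl
    exact hm (by simpa using hc)
  have hcu : ¬ IsUnit c := by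
    intro hu
    have hmg : m ∣ g := by
      have h1 : m ∣ EuclideanDomain.gcd g m := by
        obtain ⟨u, rfl⟩ := hu
        exact ⟨(↑u⁻¹ : F[X]), by nth_rewrite 2 [hc]; simp [mul_assoc]⟩
      exact h1.trans (EuclideanDomain.gcd_dvd_left g m)
    exact absurd (degree_le_of_dvd hmg hg) (not_le.mpr hdeg)
  obtain ⟨p, hp⟩ := UniqueFactorizationMonoid.exists_mem_normalizedFactors hc0 hcu
  have hcm : c ∣ m := ⟨EuclideanDomain.gcd g m, by rw [mul_comm]; exact hc⟩
  have hpm := Multiset.mem_of_le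
    ((UniqueFactorizationMonoid.dvd_iff_normalizedFactors_le_normalizedFactors hc0 hm).1 hcm) hp
  have hp0 : p ≠ 0 := (UniqueFactorizationMonoid.irreducible_of_normalized_factor p hp).ne_zero
  obtain ⟨e, he⟩ := UniqueFactorizationMonoid.dvd_of_mem_normalizedFactors hp
  refine ⟨p, hpm, EuclideanDomain.gcdA g m * e, EuclideanDomain.gcdB g m * e, ?_⟩
  have key : m = p * (EuclideanDomain.gcd g m * e) := by
    nth_rewrite 1 [hc]
    rw [he]
    ring
  have hdiv : m / p = EuclideanDomain.gcd g m * e := by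
    nth_rewrite 1 [key]
    exact mul_div_cancel_left₀ _ hp0
  rw [hdiv, EuclideanDomain.gcd_eq_gcd_ab]
  ring

open Polynomial in
/-- A nonzero polynomial has at most `natDegree` many normalized irreducible factors. -/
lemma card_normalizedFactors_le_natDegree {F : Type*} [Field F] [DecidableEq F] {m : F[X]}
    (hm : m ≠ 0) :
    Multiset.card (UniqueFactorizationMonoid.normalizedFactors m) ≤ m.natDegree := by
  have h0 : (0 : F[X]) ∉ UniqueFactorizationMonoid.normalizedFactors m :=
    UniqueFactorizationMonoid.zero_notMem_normalizedFactors m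
  have h1 : (UniqueFactorizationMonoid.normalizedFactors m).prod.natDegree = m.natDegree :=
    natDegree_eq_of_degree_eq
      (degree_eq_degree_of_associated (UniqueFactorizationMonoid.prod_normalizedFactors hm))
  rw [← h1, natDegree_multiset_prod _ h0]
  have h2 := Multiset.card_nsmul_le_sum
    (s := (UniqueFactorizationMonoid.normalizedFactors m).map natDegree) (a := 1) (by
      intro x hx
      obtain ⟨p, hp, rfl⟩ := Multiset.mem_map.1 hx
      exact (UniqueFactorizationMonoid.irreducible_of_normalized_factor p hp).natDegree_pos)
  simpa using h2

/-- The kernel of a nonzero linear map over a finite field has index at least the field's size. -/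
lemma card_mul_card_ker_le {F V W : Type*} [Field F] [Fintype F] [AddCommGroup V] [Module F V]
    [Finite V] [AddCommGroup W] [Module F W] (φ : V →ₗ[F] W) (hφ : φ ≠ 0) :
    Fintype.card F * Nat.card (LinearMap.ker φ) ≤ Nat.card V := by
  have hlt : Module.finrank F (LinearMap.ker φ) < Module.finrank F V :=
    Submodule.finrank_lt (by simpa [lt_top_iff_ne_top, LinearMap.ker_eq_top] using hφ)
  rw [Module.natCard_eq_pow_finrank (K := F) (V := LinearMap.ker φ),
    Module.natCard_eq_pow_finrank (K := F) (V := V), Nat.card_eq_fintype_card, ← pow_succ']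
  exact Nat.pow_le_pow_right Fintype.card_pos hlt

open Matrix in
/-- Over a finite field with `q` elements, a nonzero bilinear form on `Fⁿ` vanishes on at most
`(2 / q) q²ⁿ` pairs. -/
lemma card_mul_ncard_dotProduct_mulVec_eq_zero_le {F ι : Type*} [Field F] [Fintype F] [Fintype ι]
    (B : Matrix ι ι F) (hB : B ≠ 0) :
    Fintype.card F * Set.ncard {vw : (ι → F) × (ι → F) | vw.2 ⬝ᵥ (B *ᵥ vw.1) = 0}
      ≤ 2 * Fintype.card F ^ (2 * Fintype.card ι) := by
  classical
  set q := Fintype.card F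
  set n := Fintype.card ι
  have hV : Nat.card (ι → F) = q ^ n := by simp [q, n]
  have hker : q * (Finset.univ.filter fun v : ι → F => B *ᵥ v = 0).card ≤ q ^ n := by
    have h := card_mul_card_ker_le (Matrix.mulVecLin B) (by
      intro h
      exact hB (Matrix.mulVec_injective (funext fun v => by
        simpa using congrArg (fun f => f v) h)))
    rw [hV, Nat.card_eq_fintype_card] at h
    rw [← Fintype.card_subtype]
    convert h using 4
    simp
  have hfib (u : ι → F) (hu : u ≠ 0) :
      q * (Finset.univ.filter fun w : ι → F => w ⬝ᵥ u = 0).card ≤ q ^ n := by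
    have h := card_mul_card_ker_le (dotProductBilin F F u) (by
      intro h
      exact hu (dotProduct_eq_zero u fun w => by
        simpa using congrArg (fun f => f w) h))
    rw [hV, Nat.card_eq_fintype_card] at h
    rw [← Fintype.card_subtype]
    convert h using 4
    simp [dotProduct_comm]
  have hsum : Set.ncard {vw : (ι → F) × (ι → F) | vw.2 ⬝ᵥ (B *ᵥ vw.1) = 0} =
      ∑ v : ι → F, (Finset.univ.filter fun w : ι → F => w ⬝ᵥ (B *ᵥ v) = 0).card := by
    rw [Set.ncard_eq_toFinset_card', Set.toFinset_ofPred]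
    simp only [Finset.card_filter, Fintype.sum_prod_type]
  rw [hsum, Finset.mul_sum]
  calc ∑ v : ι → F, q * (Finset.univ.filter fun w : ι → F => w ⬝ᵥ (B *ᵥ v) = 0).card
      ≤ ∑ v : ι → F, ((if B *ᵥ v = 0 then q * q ^ n else 0) + q ^ n) := by
        refine Finset.sum_le_sum fun v _ => ?_
        by_cases hv : B *ᵥ v = 0
        · simp [hv, q, n]
        · simpa [hv] using hfib _ hv
    _ = q * (Finset.univ.filter fun v : ι → F => B *ᵥ v = 0).card * q ^ n + q ^ n * q ^ n := by
        rw [Finset.sum_add_distrib, ← Finset.sum_filter, Finset.sum_const, Finset.sum_const,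
          Finset.card_univ, ← Nat.card_eq_fintype_card, hV]
        simp only [smul_eq_mul]
        ring
    _ ≤ q ^ n * q ^ n + q ^ n * q ^ n := by gcongr
    _ = 2 * q ^ (2 * n) := by ring

open Matrix Polynomial in
/-- If `wᵀ g(A) Aʲ v = 0` for all `j`, then `wᵀ a(A) g(A) v = 0` for every polynomial `a`. -/
lemma dotProduct_aeval_mul_mulVec_eq_zero {R ι : Type*} [CommRing R] [Fintype ι] [DecidableEq ι]
    {A : Matrix ι ι R} {g : R[X]} {v w : ι → R}
    (h : ∀ j : ℕ, w ⬝ᵥ ((aeval A g * A ^ j) *ᵥ v) = 0) (a : R[X]) :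
    w ⬝ᵥ (aeval A (a * g) *ᵥ v) = 0 := by
  induction a using Polynomial.induction_on' with
  | add a b ha hb => simp [add_mul, Matrix.add_mulVec, ha, hb, - map_mul]
  | monomial j c =>
    have : aeval A (monomial j c * g) = c • (aeval A g * A ^ j) := by
      rw [mul_comm, map_mul, aeval_monomial, ← Algebra.smul_def, mul_smul_comm]
    rw [this, Matrix.smul_mulVec, dotProduct_smul, h, smul_zero]

open Matrix in
/-- Wiedemann / Kaltofen–Pan: for an `n × n` matrix `A` over a finite field with `q`
elements, the set of "bad" pairs `(v, w)` — those for which some nonzero polynomial `g` of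
degree less than `deg (minpoly F A)` satisfies `wᵀ · g(A) · A^j · v = 0` for all `j ≥ 0` —
has cardinality at most `(2n/q) · q^{2n}`, i.e. `q · |Bad| ≤ 2n · q^{2n}`. -/
theorem stmt8 (F : Type*) [Field F] [Fintype F] (q : ℕ) (hq : q = Fintype.card F)
    (n : ℕ) (hn : 1 ≤ n) (A : Matrix (Fin n) (Fin n) F) :
    q * Set.ncard {vw : (Fin n → F) × (Fin n → F) |
        ∃ g : Polynomial F, g ≠ 0 ∧ g.degree < (minpoly F A).degree ∧
          ∀ j : ℕ, vw.2 ⬝ᵥ ((Polynomial.aeval A g * A ^ j) *ᵥ vw.1) = 0}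
      ≤ 2 * n * q ^ (2 * n) := by
  classical
  subst hq
  have hA : IsIntegral F A := Matrix.isIntegral A
  have hm0 : minpoly F A ≠ 0 := minpoly.ne_zero hA
  set S := (UniqueFactorizationMonoid.normalizedFactors (minpoly F A)).toFinset
  let Z (p : Polynomial F) : Set ((Fin n → F) × (Fin n → F)) :=
    {vw | vw.2 ⬝ᵥ (Polynomial.aeval A (minpoly F A / p) *ᵥ vw.1) = 0}
  have hS : S.card ≤ n := by
    have h := Polynomial.natDegree_le_of_dvd (Matrix.minpoly_dvd_charpoly A)
      (Matrix.charpoly_monic A).ne_zero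
    rw [Matrix.charpoly_natDegree_eq_dim, Fintype.card_fin] at h
    exact (Multiset.toFinset_card_le _).trans ((card_normalizedFactors_le_natDegree hm0).trans h)
  have hZ (p : Polynomial F) (hp : p ∈ S) :
      Fintype.card F * (Z p).ncard ≤ 2 * Fintype.card F ^ (2 * n) := by
    have hp' := Multiset.mem_toFinset.1 hp
    have hirr := UniqueFactorizationMonoid.irreducible_of_normalized_factor p hp'
    obtain ⟨e, he⟩ := UniqueFactorizationMonoid.dvd_of_mem_normalizedFactors hp'
    have hdiv : minpoly F A / p = e := by
      rw [he]
      exact mul_div_cancel_left₀ _ hirr.ne_zero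
    have hB : Polynomial.aeval A (minpoly F A / p) ≠ 0 := by
      rw [hdiv]
      intro h0
      have he0 : e ≠ 0 := right_ne_zero_of_mul (he ▸ hm0)
      have hdvd : p * e ∣ 1 * e := by
        rw [one_mul, ← he]
        exact minpoly.dvd F A h0
      exact hirr.not_isUnit (isUnit_of_dvd_one ((mul_dvd_mul_iff_right he0).1 hdvd))
    simpa using card_mul_ncard_dotProduct_mulVec_eq_zero_le _ hB
  have hsub : {vw : (Fin n → F) × (Fin n → F) |
      ∃ g : Polynomial F, g ≠ 0 ∧ g.degree < (minpoly F A).degree ∧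
        ∀ j : ℕ, vw.2 ⬝ᵥ ((Polynomial.aeval A g * A ^ j) *ᵥ vw.1) = 0} ⊆ ⋃ p ∈ S, Z p := by
    rintro ⟨v, w⟩ ⟨g, hg, hdeg, h⟩
    obtain ⟨p, hp, a, b, hab⟩ := exists_mem_normalizedFactors_div_eq hg hdeg
    refine Set.mem_biUnion (x := p) (Multiset.mem_toFinset.2 hp) ?_
    have h0 := dotProduct_aeval_mul_mulVec_eq_zero h a
    simpa [Z, hab] using h0
  calc Fintype.card F * _
      ≤ Fintype.card F * ∑ p ∈ S, (Z p).ncard := by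
        gcongr
        exact (Set.ncard_le_ncard hsub (Set.toFinite _)).trans (S.set_ncard_biUnion_le Z)
    _ ≤ ∑ _p ∈ S, 2 * Fintype.card F ^ (2 * n) := by
        rw [Finset.mul_sum]
        exact Finset.sum_le_sum hZ
    _ = S.card * (2 * Fintype.card F ^ (2 * n)) := by simp
    _ ≤ n * (2 * Fintype.card F ^ (2 * n)) := by gcongr
    _ = 2 * n * Fintype.card F ^ (2 * n) := by ring
end

section
/- Let F be a finite field with q elements, let n ≥ 1, and let A be an n×n matrix over F with rank(A) < n. For u ∈ F^n with u_1 = 1 let U(u) be the unit upper triangular Toeplitz matrix with U(u)[i,j] = u_{j−i+1} for j ≥ i and 0 otherwise; for v ∈ F^n with v_1 = 1 let V(v) be the unit lower triangular Toeplitz matrix with V(v)[i,j] = v_{i−j+1} for i ≥ j and 0 otherwise; for d ∈ F^n let D_d be the diagonal matrix with diagonal d. Let Bad be the set of triples (u, v, d) with u_1 = v_1 = 1 such that rank(A) ≠ deg(minpoly F (U(u)·A·V(v)·D_d)) − 1. Then 2·q·|Bad| ≤ n·(3n+1)·q^{3n−2}. (Equivalently, choosing u_2,...,u_n, v_2,...,v_n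 and d_1,...,d_n uniformly at random from F, the event rank(A) = deg(minpoly(UAVD)) − 1 holds with probability at least 1 − n(3n+1)/(2q); the parameter space has q^{3n−2} elements.) -/
/-- The unit upper triangular Toeplitz matrix with `U[i,j] = u_{j-i}` (0-indexed) for
`j ≥ i` and `0` otherwise. -/
def upperToeplitz {F : Type*} [Zero F] {n : ℕ} (u : Fin n → F) :
    Matrix (Fin n) (Fin n) F :=
  Matrix.of fun i j =>
    if h : (i : ℕ) ≤ (j : ℕ) then u ⟨(j : ℕ) - (i : ℕ), by omega⟩ else 0

/-- The unit lower triangular Toeplitz matrix with `V[i,j] = v_{i-j}` (0-indexed) for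
`i ≥ j` and `0` otherwise. -/
def lowerToeplitz {F : Type*} [Zero F] {n : ℕ} (v : Fin n → F) :
    Matrix (Fin n) (Fin n) F :=
  Matrix.of fun i j =>
    if h : (j : ℕ) ≤ (i : ℕ) then v ⟨(i : ℕ) - (j : ℕ), by omega⟩ else 0

/-- A subspace of dimension at least `k` contains `k` vectors with strictly increasing leading
positions. -/
lemma exists_leading_positions {K : Type*} [Field K] {n k : ℕ} (W : Submodule K (Fin n → K))
    (hk : k ≤ Module.finrank K W) :
    ∃ (c : Fin k → Fin n) (w : Fin k → Fin n → K), StrictMono c ∧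
      ∀ j, w j ∈ W ∧ w j (c j) ≠ 0 ∧ ∀ i < c j, w j i = 0 := by
  classical
  let P : Finset (Fin n) := Finset.univ.filter fun a =>
    ∃ w ∈ W, w a ≠ 0 ∧ ∀ i < a, w i = 0
  have hP : k ≤ P.card := by
    let f : W →ₗ[K] (P → K) := (LinearMap.funLeft K K (Subtype.val : P → Fin n)).comp W.subtype
    have hf : Function.Injective f := by
      rw [← LinearMap.ker_eq_bot, LinearMap.ker_eq_bot']
      rintro ⟨w, hw⟩ hfw
      by_contra hne
      have hne' : ∃ a, w a ≠ 0 := by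
        by_contra! h
        exact hne (Subtype.ext (funext h))
      obtain ⟨a, ha, hmin⟩ := WellFounded.has_min (wellFounded_lt (α := Fin n)) {a | w a ≠ 0} hne'
      have haP : a ∈ P := by
        simp only [P, Finset.mem_filter, Finset.mem_univ, true_and]
        exact ⟨w, hw, ha, fun i hi => by_contra fun h => hmin i h hi⟩
      exact ha (congrFun hfw ⟨a, haP⟩)
    have := LinearMap.finrank_le_finrank_of_injective hf
    simp only [Module.finrank_fintype_fun_eq_card, Fintype.card_coe] at this
    omega
  have hmem : ∀ j : Fin k, ∃ w ∈ W, w (P.orderEmbOfCardLe hP j) ≠ 0 ∧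
      ∀ i < P.orderEmbOfCardLe hP j, w i = 0 := fun j => by
    have := P.orderEmbOfCardLe_mem hP j
    simpa only [P, Finset.mem_filter, Finset.mem_univ, true_and] using this
  choose w hw using hmem
  exact ⟨P.orderEmbOfCardLe hP, w, (P.orderEmbOfCardLe hP).strictMono, hw⟩

/-- A strictly increasing sequence minimises the sum of squares of truncated differences
only at the identity permutation. -/
lemma sum_sq_sub_lt_of_ne_one {k : ℕ} (c : Fin k → ℕ) (hc : StrictMono c)
    (σ : Equiv.Perm (Fin k)) (hσ : σ ≠ 1) :
    ∑ j, (c j - j) ^ 2 < ∑ j, (c j - σ j) ^ 2 := by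
  have hcj : ∀ j : Fin k, (j : ℕ) ≤ c j := by
    rintro ⟨j, hj⟩
    induction j with
    | zero => simp
    | succ j ih =>
      have h1 := ih (by omega)
      have h2 : c ⟨j, by omega⟩ < c ⟨j + 1, hj⟩ := hc (by simp [Fin.lt_def])
      simp only at h1 ⊢
      omega
  have hmono : Monovary (fun j : Fin k => (c j : ℤ) - j) (fun j : Fin k => (j : ℤ)) := by
    have : Monotone (fun j : Fin k => (c j : ℤ) - j) := by
      intro i j hij
      obtain ⟨d, hd⟩ := Nat.exists_eq_add_of_le (show (i : ℕ) ≤ j from hij)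
      have key : ∀ d (hd : (i : ℕ) + d < k), c i + d ≤ c ⟨i + d, hd⟩ := by
        intro d
        induction d with
        | zero => intro _; simp
        | succ d ih =>
          intro hd
          have h1 := ih (by omega)
          have h2 : c ⟨i + d, by omega⟩ < c ⟨i + (d + 1), hd⟩ := hc (by simp [Fin.lt_def])
          omega
      have h1 := key d (by omega)
      have h2 : (⟨i + d, by omega⟩ : Fin k) = j := Fin.ext hd.symm
      rw [h2] at h1
      simp only
      omega
    intro i j hij
    exact this (by simpa [Fin.lt_def] using hij.le)
  have hrear := hmono.sum_mul_comp_perm_le_sum_mul (σ := σ)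
  have hpt : ∀ (j i : Fin k), ((c j : ℤ) - j) ^ 2 + 2 * ((c j : ℤ) - j) * (j - i) ≤
      (((c j - i : ℕ)) : ℤ) ^ 2 := by
    intro j i
    have h1 := hcj j
    rcases le_total (i : ℕ) (c j) with h | h
    · push_cast [h]
      nlinarith [sq_nonneg ((j : ℤ) - i)]
    · rw [Nat.sub_eq_zero_of_le h]
      have h2 : ((c j : ℕ) : ℤ) ≤ i := by exact_mod_cast h
      have h3 : ((j : ℕ) : ℤ) ≤ c j := by exact_mod_cast h1
      push_cast
      nlinarith [mul_nonneg (sub_nonneg.2 h3) (sub_nonneg.2 h2), sq_nonneg ((c j : ℤ) - j)]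
  have hex : ∃ j, σ j < j := by
    by_contra! h
    apply hσ
    have hsum : ∑ j, ((σ j : ℕ)) = ∑ j : Fin k, (j : ℕ) := Equiv.sum_comp σ fun j => (j : ℕ)
    have := (Finset.sum_eq_sum_iff_of_le (s := Finset.univ)
      (f := fun j : Fin k => (j : ℕ)) (g := fun j => (σ j : ℕ)) fun j _ => h j).1 hsum.symm
    ext j
    simpa using (this j (Finset.mem_univ j)).symm
  obtain ⟨j₀, hj₀⟩ := hex
  have hlt : ∑ j, (((c j : ℤ) - j) ^ 2 + 2 * ((c j : ℤ) - j) * (j - σ j)) <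
      ∑ j, (((c j - σ j : ℕ)) : ℤ) ^ 2 := by
    refine Finset.sum_lt_sum (fun j _ => hpt j (σ j)) ⟨j₀, Finset.mem_univ _, ?_⟩
    have h1 := hcj j₀
    have h2 : (σ j₀ : ℕ) < j₀ := hj₀
    have h3 : ((σ j₀ : ℕ) : ℤ) < (j₀ : ℕ) := by exact_mod_cast h2
    have h4 : (σ j₀ : ℕ) ≤ c j₀ := by omega
    push_cast [h4]
    nlinarith
  have hsplit : ∑ j, (((c j : ℤ) - j) ^ 2 + 2 * ((c j : ℤ) - j) * (j - σ j)) =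
      ∑ j, ((c j : ℤ) - j) ^ 2 + 2 * (∑ j, ((c j : ℤ) - j) * j - ∑ j, ((c j : ℤ) - j) * σ j) := by
    rw [Finset.sum_add_distrib, ← Finset.sum_sub_distrib, Finset.mul_sum]
    congr 1
    exact Finset.sum_congr rfl fun j _ => by ring
  have hcast : ∑ j : Fin k, ((c j : ℤ) - j) ^ 2 = ∑ j : Fin k, (((c j - j : ℕ)) : ℤ) ^ 2 :=
    Finset.sum_congr rfl fun j _ => by rw [Nat.cast_sub (hcj j)]
  rw [hsplit, hcast] at hlt
  zify
  linarith

lemma upperToeplitz_map {R S : Type*} [Semiring R] [Semiring S] {n : ℕ} (f : R →+* S)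
    (u : Fin n → R) : (upperToeplitz u).map f = upperToeplitz (f ∘ u) := by
  ext i j
  simp only [upperToeplitz, Matrix.map_apply, Matrix.of_apply]
  split_ifs <;> simp

lemma lowerToeplitz_map {R S : Type*} [Semiring R] [Semiring S] {n : ℕ} (f : R →+* S)
    (v : Fin n → R) : (lowerToeplitz v).map f = lowerToeplitz (f ∘ v) := by
  ext i j
  simp only [lowerToeplitz, Matrix.map_apply, Matrix.of_apply]
  split_ifs <;> simp

lemma upperToeplitz_transpose {R : Type*} [Zero R] {n : ℕ} (u : Fin n → R) :
    (upperToeplitz u).transpose = lowerToeplitz u := rfl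

lemma upperToeplitz_smul {R : Type*} [Semiring R] {n : ℕ} (a : R) (u : Fin n → R) :
    upperToeplitz (a • u) = a • upperToeplitz u := by
  ext i j
  simp only [upperToeplitz, Matrix.smul_apply, Matrix.of_apply]
  split_ifs <;> simp

open Polynomial in
lemma coeff_prod_sum_of_natDegree_le {R ι : Type*} [CommSemiring R] (s : Finset ι) (f : ι → R[X])
    (e : ι → ℕ) (h : ∀ i ∈ s, (f i).natDegree ≤ e i) :
    (∏ i ∈ s, f i).coeff (∑ i ∈ s, e i) = ∏ i ∈ s, (f i).coeff (e i) := by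
  classical
  induction s using Finset.induction_on with
  | empty => simp
  | insert a s ha ih =>
    have hs : ∀ i ∈ s, (f i).natDegree ≤ e i := fun i hi => h i (Finset.mem_insert_of_mem hi)
    rw [Finset.prod_insert ha, Finset.sum_insert ha, Finset.prod_insert ha,
      coeff_mul_add_eq_of_natDegree_le (h a (Finset.mem_insert_self a s))
        ((natDegree_prod_le _ _).trans (Finset.sum_le_sum hs)), ih hs]

open Polynomial in
/-- For the Toeplitz preconditioner with entries `X ^ (n² - a²)`, the leading `k` rows of the
product keep rank `k`. -/
lemma exists_det_toeplitz_X_pow_mul_ne_zero {K κ : Type*} [Field K] [Fintype κ] {n k : ℕ}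
    (hkn : k ≤ n) (A : Matrix (Fin n) κ K) (hk : k ≤ A.rank) :
    ∃ Y : Matrix κ (Fin k) K,
      ((upperToeplitz (fun a : Fin n => (X : K[X]) ^ (n ^ 2 - (a : ℕ) ^ 2)) *
        (A * Y).map C).submatrix (Fin.castLE hkn) id).det ≠ 0 := by
  obtain ⟨c, w, hc, hw⟩ := exists_leading_positions (LinearMap.range A.mulVecLin) hk
  choose y hy using fun j => (hw j).1
  refine ⟨Matrix.of fun a j => y j a, ?_⟩
  have hAY : ∀ a j, (A * Matrix.of fun a j => y j a) a j = w j a := fun a j => by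
    rw [← hy j]
    rfl
  set M := (upperToeplitz (fun a : Fin n => (X : K[X]) ^ (n ^ 2 - (a : ℕ) ^ 2)) *
        (A * Matrix.of fun a j => y j a).map C).submatrix (Fin.castLE hkn) id with hM
  have hMapp : ∀ i j, M i j = ∑ a : Fin n,
      (if (i : ℕ) ≤ a then X ^ (n ^ 2 - ((a : ℕ) - i) ^ 2) else 0) * C (w j a) := fun i j => by
    simp only [hM, Matrix.submatrix_apply, Matrix.mul_apply, Matrix.map_apply, id]
    refine Finset.sum_congr rfl fun a _ => ?_
    have : (∑ b, A a b * Matrix.of (fun a j => y j a) b j) = w j a := hAY a j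
    rw [this]
    congr 1
  have hcj : ∀ j : Fin k, (j : ℕ) ≤ c j := by
    rintro ⟨j, hj⟩
    induction j with
    | zero => simp
    | succ j ih =>
      have h1 := ih (by omega)
      have h2 : c ⟨j, by omega⟩ < c ⟨j + 1, hj⟩ := hc (by simp [Fin.lt_def])
      rw [Fin.lt_def] at h2
      simp only at h1 ⊢
      omega
  have hsq : ∀ a i : ℕ, a < n → (a - i) ^ 2 ≤ n ^ 2 := fun a i h =>
    Nat.pow_le_pow_left (by omega) 2
  have hdeg : ∀ i j, (M i j).natDegree ≤ n ^ 2 - ((c j : ℕ) - i) ^ 2 := by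
    intro i j
    rw [hMapp]
    refine natDegree_sum_le_of_forall_le _ _ fun a _ => ?_
    by_cases ha : a < c j
    · simp [(hw j).2.2 a ha]
    · split_ifs with hi
      · refine (natDegree_mul_C_le _ _).trans ((natDegree_X_pow_le _).trans ?_)
        have : (c j : ℕ) ≤ a := not_lt.1 ha
        exact Nat.sub_le_sub_left (Nat.pow_le_pow_left (by omega) 2) _
      · simp
  have hcoeff : ∀ j, (M j j).coeff (n ^ 2 - ((c j : ℕ) - j) ^ 2) = w j (c j) := by
    intro j
    rw [hMapp, finsetSum_coeff, Finset.sum_eq_single (c j)]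
    · rw [if_pos (hcj j), coeff_mul_C, coeff_X_pow_self, one_mul]
    · intro a _ ha
      rcases lt_or_gt_of_ne ha with h | h
      · simp [(hw j).2.2 a h]
      · rw [Fin.lt_def] at h
        have h1 := hcj j
        rw [if_pos (by omega), coeff_mul_C, coeff_X_pow, if_neg, zero_mul]
        have h2 : ((c j : ℕ) - j) ^ 2 < ((a : ℕ) - j) ^ 2 :=
          Nat.pow_lt_pow_left (by omega) (by norm_num)
        have := hsq a j a.2
        omega
    · simp
  intro hdet
  have hz : M.det.coeff (∑ j, (n ^ 2 - ((c j : ℕ) - j) ^ 2)) = 0 := by rw [hdet, coeff_zero]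
  rw [Matrix.det_apply, finsetSum_coeff, Finset.sum_eq_single 1] at hz
  · simp only [Equiv.Perm.sign_one, one_smul, Equiv.Perm.one_apply] at hz
    rw [coeff_prod_sum_of_natDegree_le _ _ _ fun j _ => hdeg j j] at hz
    simp only [hcoeff] at hz
    exact Finset.prod_ne_zero_iff.2 (fun j _ => (hw j).2.1) hz
  · intro σ _ hσ
    rw [coeff_smul, coeff_eq_zero_of_natDegree_lt, smul_zero]
    refine (natDegree_prod_le _ _).trans_lt
      ((Finset.sum_le_sum fun j _ => hdeg (σ j) j).trans_lt ?_)
    have h1 := sum_sq_sub_lt_of_ne_one (fun j => (c j : ℕ)) hc σ hσ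
    have h2 : ∀ f : Fin k → ℕ, ∑ j, (n ^ 2 - ((c j : ℕ) - f j) ^ 2) +
        ∑ j, ((c j : ℕ) - f j) ^ 2 = ∑ _j : Fin k, n ^ 2 := fun f => by
      rw [← Finset.sum_add_distrib]
      exact Finset.sum_congr rfl fun j _ => Nat.sub_add_cancel (hsq _ _ (c j).2)
    have h3 := h2 fun j => j
    have h4 := h2 fun j => σ j
    omega
  · simp

open Polynomial in
/-- Over an infinite field a single unit Toeplitz matrix brings finitely many matrices
simultaneously into a position where their leading rows have full rank. -/
lemma exists_upperToeplitz_mul_det_ne_zero {K ι : Type*} [Field K] [Infinite K] [Fintype ι]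
    {n : ℕ} (κ : ι → Type*) [∀ i, Fintype (κ i)] (k : ι → ℕ) (hkn : ∀ i, k i ≤ n + 1)
    (A : ∀ i, Matrix (Fin (n + 1)) (κ i) K) (hk : ∀ i, k i ≤ (A i).rank) :
    ∃ u : Fin (n + 1) → K, u 0 = 1 ∧ ∀ i, ∃ Y : Matrix (κ i) (Fin (k i)) K,
      ((upperToeplitz u * (A i * Y)).submatrix (Fin.castLE (hkn i)) id).det ≠ 0 := by
  choose Y hY using fun i => exists_det_toeplitz_X_pow_mul_ne_zero (hkn i) (A i) (hk i)
  set U : Fin (n + 1) → K[X] := fun a => X ^ ((n + 1) ^ 2 - (a : ℕ) ^ 2)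
  set P : K[X] := X * ∏ i, ((upperToeplitz U * (A i * Y i).map C).submatrix
    (Fin.castLE (hkn i)) id).det
  have hP : P ≠ 0 := mul_ne_zero X_ne_zero (Finset.prod_ne_zero_iff.2 fun i _ => hY i)
  obtain ⟨t, ht⟩ : ∃ t, P.eval t ≠ 0 := by
    by_contra! h
    exact hP (funext fun t => by simpa using h t)
  simp only [P, eval_mul, eval_X, eval_prod] at ht
  have ht0 : t ≠ 0 := left_ne_zero_of_mul ht
  have hti := Finset.prod_ne_zero_iff.1 (right_ne_zero_of_mul ht)
  set a : K := t ^ ((n + 1) ^ 2)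
  have ha : a ≠ 0 := pow_ne_zero _ ht0
  refine ⟨a⁻¹ • (evalRingHom t ∘ U), by simp [U, a, ha], fun i => ⟨Y i, ?_⟩⟩
  have h := hti i (Finset.mem_univ i)
  rw [← coe_evalRingHom, RingHom.map_det, RingHom.mapMatrix_apply, ← Matrix.submatrix_map,
    Matrix.map_mul, upperToeplitz_map] at h
  have hC : ((A i * Y i).map C).map (evalRingHom t) = A i * Y i := by
    ext a b
    simp only [Matrix.map_apply, coe_evalRingHom, eval_C]
  rw [hC] at h
  rw [upperToeplitz_smul, Matrix.smul_mul]
  have hs : ∀ B : Matrix (Fin (n + 1)) (Fin (k i)) K, (a⁻¹ • B).submatrix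
      (Fin.castLE (hkn i)) id = a⁻¹ • B.submatrix (Fin.castLE (hkn i)) id := fun _ => rfl
  rw [hs, Matrix.det_smul]
  exact mul_ne_zero (pow_ne_zero _ (inv_ne_zero ha)) h

/-- Over an infinite field some Toeplitz preconditioning makes the leading principal minors of
sizes up to the rank nonzero. -/
lemma exists_toeplitz_leading_minors_ne_zero {K : Type*} [Field K] [Infinite K] {n : ℕ}
    (A : Matrix (Fin (n + 1)) (Fin (n + 1)) K) :
    ∃ u v : Fin (n + 1) → K, u 0 = 1 ∧ v 0 = 1 ∧ ∀ k (hk : k ≤ n + 1), k ≤ A.rank →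
      ((upperToeplitz u * A * lowerToeplitz v).submatrix (Fin.castLE hk)
        (Fin.castLE hk)).det ≠ 0 := by
  have hr : A.rank ≤ n + 1 := A.rank_le_width
  obtain ⟨u, hu, hY⟩ := exists_upperToeplitz_mul_det_ne_zero (ι := Fin (A.rank + 1))
    (fun _ => Fin (n + 1)) (fun i => (i : ℕ)) (fun i => by omega) (fun _ => A) (fun i => by omega)
  choose Y hY using hY
  have hle : ∀ i : Fin (A.rank + 1), (i : ℕ) ≤ n + 1 := fun i => by omega
  obtain ⟨v, hv, hZ⟩ := exists_upperToeplitz_mul_det_ne_zero (ι := Fin (A.rank + 1))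
    (fun i => Fin i) (fun i => (i : ℕ)) hle
    (fun i => ((upperToeplitz u * A).submatrix (Fin.castLE (hle i)) id).transpose) (fun i => by
      rw [Matrix.rank_transpose]
      have h1 := Matrix.rank_of_det_ne_zero (hY i)
      rw [Fintype.card_fin] at h1
      calc (i : ℕ) = _ := h1.symm
        _ = ((upperToeplitz u * A).submatrix (Fin.castLE (hle i)) id * Y i).rank := by
          rw [← Matrix.mul_assoc]
          rfl
        _ ≤ _ := Matrix.rank_mul_le_left _ _)
  refine ⟨u, v, hu, hv, fun k hk hkr => ?_⟩
  obtain ⟨Z, hZ⟩ := hZ ⟨k, by omega⟩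
  rw [← Matrix.mul_assoc] at hZ
  set B := (upperToeplitz u * A).submatrix (Fin.castLE hk) id with hB
  have h1 : ((upperToeplitz v * B.transpose).submatrix (Fin.castLE hk) id * Z).det ≠ 0 := hZ
  rw [Matrix.det_mul] at h1
  have h2 := left_ne_zero_of_mul h1
  rw [← Matrix.det_transpose] at h2
  convert h2 using 2
  rw [Matrix.transpose_submatrix, Matrix.transpose_mul, Matrix.transpose_transpose,
    upperToeplitz_transpose]
  rfl

open Polynomial in
/-- The minimal polynomial of a matrix has degree at most its rank plus one. -/
lemma Matrix.natDegree_minpoly_le_rank_add_one {F n : Type*} [Field F] [Fintype n] [DecidableEq n]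
    (B : Matrix n n F) : (minpoly F B).natDegree ≤ B.rank + 1 := by
  set f := Matrix.toLin' B
  set g : Module.End F (LinearMap.range f) :=
    f.restrict (p := LinearMap.range f) (q := LinearMap.range f) fun x _ => ⟨x, rfl⟩
  have hg : ∀ (p : F[X]) (x : LinearMap.range f), aeval f p x = (aeval g p x : n → F) := by
    intro p
    induction p using Polynomial.induction_on' with
    | add p q hp hq => intro x; simp [hp, hq]
    | monomial k a =>
      intro x
      have : ∀ x : LinearMap.range f, (f ^ k) (x : n → F) = ((g ^ k) x : n → F) := by
        induction k with
        | zero => intro x; rfl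
        | succ k ih => intro x; rw [pow_succ, pow_succ]; exact ih (g x)
      simp [aeval_monomial, this]
  have hzero : aeval f (g.charpoly * X) = 0 := by
    refine LinearMap.ext fun x => ?_
    rw [map_mul, aeval_X]
    have := hg g.charpoly ⟨f x, x, rfl⟩
    rw [LinearMap.aeval_self_charpoly] at this
    simpa using this
  have hmonic : (g.charpoly * X).Monic := g.charpoly_monic.mul monic_X
  have h := natDegree_le_natDegree (minpoly.min F f hmonic hzero)
  rw [Matrix.minpoly_toLin', natDegree_mul_X g.charpoly_monic.ne_zero,
    LinearMap.charpoly_natDegree] at h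
  exact h

/-- Extending scalars does not decrease the rank of a square matrix. -/
lemma Matrix.rank_le_rank_map {F K n : Type*} [Field F] [Field K] [Fintype n] [DecidableEq n]
    (f : F →+* K) (A : Matrix n n F) : A.rank ≤ (A.map f).rank := by
  obtain ⟨V, U, e, -, -, h⟩ := A.exists_rank_normal_form
  have h1 := congrArg (fun M => ((M.map f).submatrix (e.symm ∘ Sum.inl)
    (e.symm ∘ Sum.inl)).rank) h
  have h2 : (((Matrix.fromBlocks (1 : Matrix (Fin A.rank) (Fin A.rank) F) 0 0
      (0 : Matrix (Fin (Fintype.card n - A.rank)) (Fin (Fintype.card n - A.rank)) F)).submatrix e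
        e).map f).submatrix (e.symm ∘ Sum.inl) (e.symm ∘ Sum.inl) = 1 := by
    ext i j
    simp [Matrix.one_apply, apply_ite f]
  simp only [h2, Matrix.rank_one, Fintype.card_fin] at h1
  rw [Matrix.map_mul, Matrix.map_mul] at h1
  rw [← h1]
  exact (Matrix.rank_submatrix_le _ _ _).trans
    ((Matrix.rank_mul_le_left _ _).trans (Matrix.rank_mul_le_right _ _))

lemma Matrix.submatrix_mul_of_cols_eq_zero {R ι κ : Type*} [CommRing R] [Fintype ι] [Fintype κ]
    {e : ι → κ} (he : Function.Injective e) (B Z : Matrix κ κ R)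
    (hB : ∀ i, ∀ j ∉ Set.range e, B i j = 0) :
    (B * Z).submatrix e e = B.submatrix e e * Z.submatrix e e := by
  ext i j
  simp only [Matrix.submatrix_apply, Matrix.mul_apply]
  symm
  refine Fintype.sum_of_injective e he _ _ (fun a ha => ?_) (fun a => rfl)
  simp [hB _ a ha]

open Polynomial in
lemma Matrix.aeval_submatrix_of_cols_eq_zero {R ι κ : Type*} [CommRing R] [Fintype ι] [Fintype κ]
    [DecidableEq ι] [DecidableEq κ] {e : ι → κ} (he : Function.Injective e) (B : Matrix κ κ R)
    (hB : ∀ i, ∀ j ∉ Set.range e, B i j = 0) (p : R[X]) :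
    (aeval B p).submatrix e e = aeval (B.submatrix e e) p := by
  induction p using Polynomial.induction_on' with
  | add p q hp hq => rw [map_add, map_add, ← hp, ← hq]; rfl
  | monomial k a =>
    have : (B ^ k).submatrix e e = B.submatrix e e ^ k := by
      induction k with
      | zero => rw [pow_zero, pow_zero, Matrix.submatrix_one _ he]
      | succ k ih => rw [pow_succ', pow_succ', Matrix.submatrix_mul_of_cols_eq_zero he _ _ hB, ih]
    simp only [aeval_monomial, ← this, Algebra.algebraMap_eq_smul_one, smul_mul_assoc, one_mul]
    rfl

open Polynomial in
/-- If `B` vanishes in all columns outside a proper subset of indices, and the block of `B` on that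
subset is invertible, then the minimal polynomial of `B` is of larger degree than that of the
block. -/
lemma Matrix.natDegree_minpoly_submatrix_lt {F ι κ : Type*} [Field F] [Fintype ι] [Fintype κ]
    [DecidableEq ι] [DecidableEq κ] {e : ι → κ} (he : Function.Injective e) (B : Matrix κ κ F)
    (hB : ∀ i, ∀ j ∉ Set.range e, B i j = 0) {j₀ : κ} (hj₀ : j₀ ∉ Set.range e)
    (hdet : (B.submatrix e e).det ≠ 0) :
    (minpoly F (B.submatrix e e)).natDegree < (minpoly F B).natDegree := by
  set M := B.submatrix e e
  have hM : minpoly F M ≠ 0 := minpoly.ne_zero (Matrix.isIntegral M)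
  have hBne : minpoly F B ≠ 0 := minpoly.ne_zero (Matrix.isIntegral B)
  have hdvd : minpoly F M ∣ minpoly F B := minpoly.dvd F M (by
    rw [← Matrix.aeval_submatrix_of_cols_eq_zero he B hB, minpoly.aeval]; rfl)
  have hX : X ∣ minpoly F B := by
    rw [X_dvd_iff]
    have h := minpoly.aeval F B
    rw [← divX_mul_X_add (minpoly F B)] at h
    simp only [map_add, map_mul, aeval_X, aeval_C] at h
    have h' := congrFun (congrFun h j₀) j₀
    simpa [Matrix.mul_apply, hB _ j₀ hj₀, Algebra.algebraMap_eq_smul_one] using h'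
  have hcop : IsCoprime X (minpoly F M) := by
    rw [Irreducible.coprime_iff_not_dvd irreducible_X]
    rintro ⟨h, hh⟩
    have h0 : h ≠ 0 := by rintro rfl; exact hM (by simpa using hh)
    have h1 : M * aeval M h = 0 := by
      have := minpoly.aeval F M
      rwa [hh, map_mul, aeval_X] at this
    have h2 : aeval M h = 0 := by
      have := congrArg (M⁻¹ * ·) h1
      simpa [← mul_assoc, Matrix.nonsing_inv_mul M (isUnit_iff_ne_zero.2 hdet)] using this
    have h3 := natDegree_le_of_dvd (minpoly.dvd F M h2) h0
    rw [hh, natDegree_X_mul h0] at h3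
    omega
  have h := natDegree_le_of_dvd (hcop.mul_dvd hX hdvd) hBne
  rw [natDegree_X_mul hM] at h
  omega

/-- The determinant of the array obtained by applying `s` linear functionals to the first `s`
powers of a matrix. -/
def krylovDet {K R n : Type*} [CommRing K] [CommRing R] [Algebra K R] [Fintype n] [DecidableEq n]
    {s : ℕ} (L : Fin s → n → n → K) (B : Matrix n n R) : R :=
  Matrix.det (Matrix.of fun k l : Fin s =>
    ∑ i, ∑ j, algebraMap K R (L k i j) * (B ^ (l : ℕ)) i j)

lemma map_krylovDet {K R S n : Type*} [CommRing K] [CommRing R] [CommRing S] [Algebra K R]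
    [Algebra K S] [Fintype n] [DecidableEq n] {s : ℕ} (φ : R →ₐ[K] S) (L : Fin s → n → n → K)
    (B : Matrix n n R) : φ (krylovDet L B) = krylovDet L (B.map φ) := by
  rw [krylovDet, AlgHom.map_det, krylovDet]
  congr 1
  ext k l
  have : B.map φ ^ (l : ℕ) = (B ^ (l : ℕ)).map φ := (map_pow φ.mapMatrix B l).symm
  simp [this]

lemma exists_krylovDet_ne_zero {K n : Type*} [Field K] [Fintype n] [DecidableEq n]
    {s : ℕ} (B : Matrix n n K) (hs : s ≤ (minpoly K B).natDegree) :
    ∃ L : Fin s → n → n → K, krylovDet L B ≠ 0 := by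
  have hli : LinearIndependent K fun l : Fin s => B ^ (l : ℕ) :=
    (linearIndependent_pow B).comp (Fin.castLE hs) (Fin.castLE_injective hs)
  obtain ⟨g, hg⟩ := LinearMap.exists_leftInverse_of_injective
    (Fintype.linearCombination K fun l : Fin s => B ^ (l : ℕ))
    (linearIndependent_iff_injective_fintypeLinearCombination.1 hli |> LinearMap.ker_eq_bot.2)
  refine ⟨fun k i j => g (Matrix.single i j 1) k, ?_⟩
  have hone : (Matrix.of fun k l : Fin s => ∑ i, ∑ j, algebraMap K K (g (Matrix.single i j 1) k) *
      (B ^ (l : ℕ)) i j) = 1 := by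
    ext k l
    have h1 := congrFun (LinearMap.congr_fun hg (Pi.single l 1)) k
    simp only [LinearMap.comp_apply, Fintype.linearCombination_apply_single, one_smul] at h1
    rw [Matrix.matrix_eq_sum_single (B ^ (l : ℕ))] at h1
    simp only [map_sum, Finset.sum_apply] at h1
    rw [Matrix.of_apply, Matrix.one_apply]
    have h2 : ∀ i j, g (Matrix.single i j ((B ^ (l : ℕ)) i j)) k =
        algebraMap K K (g (Matrix.single i j 1) k) * (B ^ (l : ℕ)) i j := fun i j => by
      have : Matrix.single i j ((B ^ (l : ℕ)) i j) =
          ((B ^ (l : ℕ)) i j) • (Matrix.single i j 1 : Matrix n n K) := by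
        rw [Matrix.smul_single, smul_eq_mul, mul_one]
      rw [this, map_smul, Pi.smul_apply, smul_eq_mul, mul_comm]
      rfl
    simp only [h2] at h1
    rw [h1]
    simp [Pi.single_apply]
  rw [krylovDet, hone, Matrix.det_one]
  exact one_ne_zero

open Polynomial in
lemma le_natDegree_minpoly_of_krylovDet_ne_zero {K n : Type*} [Field K] [Fintype n]
    [DecidableEq n] {s : ℕ} {L : Fin s → n → n → K} {B : Matrix n n K} (h : krylovDet L B ≠ 0) :
    s ≤ (minpoly K B).natDegree := by
  by_contra! hlt
  apply h
  rw [krylovDet, ← Matrix.exists_mulVec_eq_zero_iff]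
  refine ⟨fun l => (minpoly K B).coeff l, fun h0 => ?_, ?_⟩
  · have h1 := congrFun h0 ⟨_, hlt⟩
    have h2 : (minpoly K B).coeff (minpoly K B).natDegree = 1 :=
      minpoly.monic (Matrix.isIntegral B)
    simp [h2] at h1
  · ext k
    have h1 : ∑ l : Fin s, (minpoly K B).coeff l • B ^ (l : ℕ) = 0 := by
      rw [Fin.sum_univ_eq_sum_range (fun l => (minpoly K B).coeff l • B ^ l),
        ← aeval_eq_sum_range' hlt, minpoly.aeval]
    have h2 : ∀ i j, ∑ l : Fin s, (minpoly K B).coeff l * (B ^ (l : ℕ)) i j = 0 := fun i j => by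
      have := congrFun (congrFun h1 i) j
      simpa [Matrix.sum_apply] using this
    simp only [Matrix.mulVec, dotProduct, Matrix.of_apply, Finset.sum_mul, Pi.zero_apply]
    rw [Finset.sum_comm]
    refine Finset.sum_eq_zero fun i _ => ?_
    rw [Finset.sum_comm]
    refine Finset.sum_eq_zero fun j _ => ?_
    calc _ = L k i j * ∑ l : Fin s, (minpoly K B).coeff l * (B ^ (l : ℕ)) i j := by
          rw [Finset.mul_sum]
          exact Finset.sum_congr rfl fun l _ => by
            rw [Algebra.algebraMap_self, RingHom.id_apply]; ring
      _ = 0 := by rw [h2, mul_zero]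

lemma totalDegree_matrix_mul_le {K σ l m n : Type*} [CommRing K] [Fintype m]
    {M : Matrix l m (MvPolynomial σ K)} {N : Matrix m n (MvPolynomial σ K)} {a b : ℕ}
    (hM : ∀ i j, (M i j).totalDegree ≤ a) (hN : ∀ i j, (N i j).totalDegree ≤ b) (i : l) (j : n) :
    ((M * N) i j).totalDegree ≤ a + b :=
  MvPolynomial.totalDegree_finsetSum_le fun k _ =>
    (MvPolynomial.totalDegree_mul _ _).trans (add_le_add (hM i k) (hN k j))

lemma totalDegree_krylovDet_le {K σ n : Type*} [CommRing K] [Fintype n] [DecidableEq n]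
    {s t : ℕ} (L : Fin s → n → n → K) {B : Matrix n n (MvPolynomial σ K)}
    (hB : ∀ i j, (B i j).totalDegree ≤ t) :
    (krylovDet L B).totalDegree ≤ ∑ l : Fin s, t * l := by
  have hpow : ∀ (l : ℕ) i j, ((B ^ l) i j).totalDegree ≤ t * l := by
    intro l
    induction l with
    | zero =>
      intro i j
      rw [pow_zero, Matrix.one_apply]
      split_ifs <;> simp
    | succ l ih =>
      intro i j
      rw [pow_succ, mul_add, mul_one]
      exact totalDegree_matrix_mul_le ih hB i j
  rw [krylovDet, Matrix.det_apply]
  refine MvPolynomial.totalDegree_finsetSum_le fun τ _ => ?_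
  refine (MvPolynomial.totalDegree_smul_le _ _).trans
    ((MvPolynomial.totalDegree_finsetProd _ _).trans (Finset.sum_le_sum fun l _ => ?_))
  refine MvPolynomial.totalDegree_finsetSum_le fun i _ =>
    MvPolynomial.totalDegree_finsetSum_le fun j _ =>
      (MvPolynomial.totalDegree_mul _ _).trans ?_
  rw [MvPolynomial.algebraMap_eq, MvPolynomial.totalDegree_C, zero_add]
  exact hpow l i j

lemma Matrix.natDegree_minpoly_lt_of_diagonal_eq_zero {F ι κ : Type*} [Field F] [Fintype ι]
    [Fintype κ] [DecidableEq ι] [DecidableEq κ] {e : ι → κ} (he : Function.Injective e)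
    (M : Matrix κ κ F) (d : κ → F) (hd : ∀ j ∉ Set.range e, d j = 0) {j₀ : κ}
    (hj₀ : j₀ ∉ Set.range e)
    (hdet : (M.submatrix e e * Matrix.diagonal (d ∘ e)).det ≠ 0) :
    (minpoly F (M.submatrix e e * Matrix.diagonal (d ∘ e))).natDegree <
      (minpoly F (M * Matrix.diagonal d)).natDegree := by
  have h : M.submatrix e e * Matrix.diagonal (d ∘ e) =
      (M * Matrix.diagonal d).submatrix e e := by
    ext i j
    simp [Matrix.mul_diagonal]
  rw [h] at hdet ⊢
  exact Matrix.natDegree_minpoly_submatrix_lt he _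
    (fun i j hj => by simp [Matrix.mul_diagonal, hd j hj]) hj₀ hdet

open Polynomial in
/-- A matrix over an infinite field whose leading principal minors are all nonzero can be scaled by
an invertible diagonal matrix to have a minimal polynomial of full degree. -/
lemma exists_diagonal_natDegree_minpoly {K : Type*} [Field K] [Infinite K] {k : ℕ}
    (M : Matrix (Fin k) (Fin k) K)
    (hM : ∀ j (hj : j ≤ k), (M.submatrix (Fin.castLE hj) (Fin.castLE hj)).det ≠ 0) :
    ∃ d : Fin k → K, k ≤ (minpoly K (M * Matrix.diagonal d)).natDegree ∧
      (M * Matrix.diagonal d).det ≠ 0 := by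
  induction k with
  | zero => exact ⟨0, Nat.zero_le _, by simp⟩
  | succ k ih =>
    have hMdet : M.det ≠ 0 := hM (k + 1) le_rfl
    obtain ⟨d', hd', hdet⟩ := ih (M.submatrix Fin.castSucc Fin.castSucc) fun j hj =>
      hM j (hj.trans k.le_succ)
    set d₀ : Fin (k + 1) → K := Fin.snoc d' 0
    have hd₀ : d₀ ∘ Fin.castSucc = d' := by
      ext i
      simp [d₀]
    rw [← hd₀] at hd' hdet
    have hlt := hd'.trans_lt (Matrix.natDegree_minpoly_lt_of_diagonal_eq_zero
      (Fin.castSucc_injective k) M d₀ (j₀ := Fin.last k) (fun j hj => by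
        induction j using Fin.lastCases with
        | last => simp [d₀]
        | cast i => exact absurd ⟨i, rfl⟩ hj)
      (by rintro ⟨i, hi⟩; exact (Fin.castSucc_lt_last i).ne hi) hdet)
    obtain ⟨L, hL⟩ := exists_krylovDet_ne_zero (s := k + 1) _ hlt
    set P : K[X] := krylovDet L
      (M.map C * Matrix.diagonal (Fin.snoc (fun i => C (d' i)) X : Fin (k + 1) → K[X]))
    have hP : ∀ ε, P.eval ε = krylovDet L (M * Matrix.diagonal (Fin.snoc d' ε)) := by
      intro ε
      have h := map_krylovDet (aeval (R := K) ε) L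
        (M.map C * Matrix.diagonal (Fin.snoc (fun i => C (d' i)) X : Fin (k + 1) → K[X]))
      rw [coe_aeval_eq_eval] at h
      rw [h]
      congr 1
      ext i j
      rw [Matrix.map_apply, Matrix.mul_diagonal, Matrix.mul_diagonal]
      induction j using Fin.lastCases <;> simp
    have hXP : X * P ≠ 0 := by
      refine mul_ne_zero X_ne_zero fun h => hL ?_
      rw [← hP 0, h, eval_zero]
    obtain ⟨ε, hε⟩ : ∃ ε, (X * P).eval ε ≠ 0 := by
      by_contra! h
      exact hXP (Polynomial.funext fun x => by rw [h x, eval_zero])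
    rw [eval_mul, eval_X, hP] at hε
    refine ⟨Fin.snoc d' ε, le_natDegree_minpoly_of_krylovDet_ne_zero (right_ne_zero_of_mul hε), ?_⟩
    rw [Matrix.det_mul, Matrix.det_diagonal, hd₀] at hdet
    rw [Matrix.det_mul, Matrix.det_diagonal, Fin.prod_univ_castSucc]
    simpa using ⟨hMdet, right_ne_zero_of_mul hdet, left_ne_zero_of_mul hε⟩

lemma exists_toeplitz_diagonal_natDegree_minpoly {K : Type*} [Field K] [Infinite K] {n r : ℕ}
    (A : Matrix (Fin (n + 1)) (Fin (n + 1)) K) (hr : r ≤ A.rank) (hrn : r < n + 1) :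
    ∃ u v d : Fin (n + 1) → K, u 0 = 1 ∧ v 0 = 1 ∧ r + 1 ≤
      (minpoly K (upperToeplitz u * A * lowerToeplitz v * Matrix.diagonal d)).natDegree := by
  obtain ⟨u, v, hu, hv, h⟩ := exists_toeplitz_leading_minors_ne_zero A
  obtain ⟨d, hd, hdet⟩ := exists_diagonal_natDegree_minpoly
    ((upperToeplitz u * A * lowerToeplitz v).submatrix (Fin.castLE hrn.le) (Fin.castLE hrn.le))
    fun j hj => h j (hj.trans hrn.le) (hj.trans hr)
  set d₀ : Fin (n + 1) → K := fun i => if hi : (i : ℕ) < r then d ⟨i, hi⟩ else 0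
  have hd₀ : d₀ ∘ Fin.castLE hrn.le = d := by
    ext i
    simp [d₀]
  rw [← hd₀] at hd hdet
  refine ⟨u, v, d₀, hu, hv, hd.trans_lt (Matrix.natDegree_minpoly_lt_of_diagonal_eq_zero
    (Fin.castLE_injective hrn.le) _ d₀ (j₀ := ⟨r, hrn⟩) (fun j hj => dif_neg fun hi => hj
      ⟨⟨j, hi⟩, rfl⟩) ?_ hdet)⟩
  rintro ⟨i, hi⟩
  exact i.2.ne (congrArg Fin.val hi)

open Polynomial in
/-- Extending scalars does not increase the degree of the minimal polynomial of a matrix. -/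
lemma Matrix.natDegree_minpoly_map_le {F K n : Type*} [Field F] [Field K] [Algebra F K] [Fintype n]
    [DecidableEq n] (B : Matrix n n F) :
    (minpoly K (B.map (algebraMap F K))).natDegree ≤ (minpoly F B).natDegree := by
  have h : aeval (B.map (algebraMap F K)) ((minpoly F B).map (algebraMap F K)) = 0 := by
    rw [aeval_map_algebraMap]
    have := aeval_algHom_apply (Algebra.ofId F K).mapMatrix B (minpoly F B)
    rw [minpoly.aeval, map_zero] at this
    exact this
  exact (natDegree_le_natDegree (minpoly.min K _
    ((minpoly.monic (Matrix.isIntegral B)).map _) h)).trans natDegree_map_le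

/-- The product `U(u) * A * V(v) * D_d`, with `u` and `v` normalised to have first entry `1`. -/
def toeplitzPrecondition {R : Type*} [CommRing R] {m : ℕ} (A : Matrix (Fin (m + 1)) (Fin (m + 1)) R)
    (x : Fin m ⊕ Fin m ⊕ Fin (m + 1) → R) : Matrix (Fin (m + 1)) (Fin (m + 1)) R :=
  upperToeplitz (Fin.cons 1 (x ∘ Sum.inl) : Fin (m + 1) → R) * A *
    lowerToeplitz (Fin.cons 1 (x ∘ Sum.inr ∘ Sum.inl) : Fin (m + 1) → R) *
    Matrix.diagonal (x ∘ Sum.inr ∘ Sum.inr)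

lemma toeplitzPrecondition_map {R S : Type*} [CommRing R] [CommRing S] (f : R →+* S) {m : ℕ}
    (A : Matrix (Fin (m + 1)) (Fin (m + 1)) R) (x : Fin m ⊕ Fin m ⊕ Fin (m + 1) → R) :
    (toeplitzPrecondition A x).map f = toeplitzPrecondition (A.map f) (f ∘ x) := by
  have hcons : ∀ y : Fin m → R, f ∘ (Fin.cons 1 y : Fin (m + 1) → R) = Fin.cons 1 (f ∘ y) := by
    intro y
    ext i
    induction i using Fin.cases <;> simp
  simp only [toeplitzPrecondition, Matrix.map_mul, upperToeplitz_map, lowerToeplitz_map, hcons]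
  rw [Matrix.diagonal_map (map_zero f)]
  rfl

open MvPolynomial in
lemma totalDegree_toeplitzPrecondition_le {K : Type*} [CommRing K] {m : ℕ}
    (A : Matrix (Fin (m + 1)) (Fin (m + 1)) K) (i j : Fin (m + 1)) :
    (toeplitzPrecondition (A.map C) (X (R := K)) i j).totalDegree ≤ 3 := by
  have hX : ∀ s : Fin m ⊕ Fin m ⊕ Fin (m + 1), (X s : MvPolynomial _ K).totalDegree ≤ 1 := by
    intro s
    exact (totalDegree_monomial_le _ _).trans (by simp)
  have hcons : ∀ (g : Fin m → Fin m ⊕ Fin m ⊕ Fin (m + 1)) i,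
      ((Fin.cons 1 (X (R := K) ∘ g) : Fin (m + 1) → MvPolynomial _ K) i).totalDegree ≤ 1 := by
    intro g i
    induction i using Fin.cases with
    | zero => simp
    | succ i => exact hX _
  refine totalDegree_matrix_mul_le (a := 2) (b := 1) (totalDegree_matrix_mul_le (a := 1) (b := 1)
    (totalDegree_matrix_mul_le (a := 1) (b := 0) ?_ ?_) ?_) ?_ i j <;> intro i j
  · simp only [upperToeplitz, Matrix.of_apply]
    split_ifs
    · exact hcons _ _
    · simp
  · simp
  · simp only [lowerToeplitz, Matrix.of_apply]
    split_ifs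
    · exact hcons _ _
    · simp
  · rw [Matrix.diagonal_apply]
    split_ifs
    · exact hX _
    · simp

open MvPolynomial in
/-- If `A` is singular of rank `r` then, outside the zero set of a nonzero polynomial of degree at
most `3 r (r + 1) / 2`, the Toeplitz preconditioner makes the minimal polynomial of degree
`r + 1`. -/
lemma exists_polynomial_of_rank_ne_natDegree_minpoly {F K : Type*} [Field F] [Field K] [Infinite K]
    [Algebra F K] {m : ℕ} (A : Matrix (Fin (m + 1)) (Fin (m + 1)) F) (hA : A.rank < m + 1) :
    ∃ P : MvPolynomial (Fin m ⊕ Fin m ⊕ Fin (m + 1)) K, P ≠ 0 ∧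
      2 * P.totalDegree ≤ 3 * (A.rank * (A.rank + 1)) ∧
      ∀ x : Fin m ⊕ Fin m ⊕ Fin (m + 1) → F,
        A.rank ≠ (minpoly F (toeplitzPrecondition A x)).natDegree - 1 →
        eval (algebraMap F K ∘ x) P = 0 := by
  obtain ⟨u, v, d, hu, hv, h⟩ := exists_toeplitz_diagonal_natDegree_minpoly
    (A.map (algebraMap F K)) (Matrix.rank_le_rank_map (algebraMap F K) A) hA
  obtain ⟨L, hL⟩ := exists_krylovDet_ne_zero _ h
  set P := krylovDet L
    (toeplitzPrecondition ((A.map (algebraMap F K)).map C) (X (R := K)))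
  have hP : ∀ x, eval x P =
      krylovDet L (toeplitzPrecondition (A.map (algebraMap F K)) x) := by
    intro x
    have h := map_krylovDet (aeval (R := K) x) L
      (toeplitzPrecondition ((A.map (algebraMap F K)).map C) (X (R := K)))
    have hx : ⇑(aeval (R := K) x) = ⇑(eval x) := congrArg DFunLike.coe (coe_aeval_eq_eval x)
    rw [hx] at h
    refine h.trans ?_
    congr 1
    refine (toeplitzPrecondition_map (eval x) _ _).trans ?_
    congr 1
    · ext i j
      simp
    · ext s
      simp
  refine ⟨P, fun h0 => hL ?_, ?_, fun x hx => ?_⟩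
  · have h1 := hP (Sum.elim (Fin.tail u) (Sum.elim (Fin.tail v) d))
    rw [h0, map_zero] at h1
    rw [h1, toeplitzPrecondition, ← hu]
    congr 5
    · exact (Fin.cons_self_tail u).symm
    · rw [hu, ← hv]
      exact (Fin.cons_self_tail v).symm
  · have h1 := totalDegree_krylovDet_le L
      (totalDegree_toeplitzPrecondition_le (A.map (algebraMap F K)))
    rw [Fin.sum_univ_eq_sum_range (fun l => 3 * l), ← Finset.mul_sum] at h1
    have h2 := Finset.sum_range_id_mul_two (A.rank + 1)
    rw [Nat.add_sub_cancel] at h2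
    calc 2 * P.totalDegree ≤ 2 * (3 * ∑ i ∈ Finset.range (A.rank + 1), i) :=
          Nat.mul_le_mul_left 2 h1
      _ = 3 * ((∑ i ∈ Finset.range (A.rank + 1), i) * 2) := by ring
      _ = _ := by rw [h2]; ring
  · by_contra hne
    rw [hP, ← toeplitzPrecondition_map] at hne
    have h1 := (le_natDegree_minpoly_of_krylovDet_ne_zero hne).trans
      (Matrix.natDegree_minpoly_map_le _)
    have h2 := Matrix.natDegree_minpoly_le_rank_add_one (toeplitzPrecondition A x)
    have h3 : (toeplitzPrecondition A x).rank ≤ A.rank :=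
      (Matrix.rank_mul_le_left _ _).trans ((Matrix.rank_mul_le_left _ _).trans
        (Matrix.rank_mul_le_right _ _))
    omega

open MvPolynomial in
/-- The Schwartz–Zippel lemma over a finite field, for a polynomial with coefficients in an
extension field. -/
lemma card_mul_ncard_zeros_le {F K σ : Type*} [Field F] [Fintype F] [Field K] [Algebra F K]
    [Fintype σ] {P : MvPolynomial σ K} (hP : P ≠ 0) :
    Fintype.card F * {x : σ → F | eval (algebraMap F K ∘ x) P = 0}.ncard ≤
      P.totalDegree * Fintype.card F ^ Fintype.card σ := by
  classical
  set e := Fintype.equivFin σ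
  set S : Finset K := Finset.univ.image (algebraMap F K)
  have hS : S.card = Fintype.card F :=
    Finset.card_image_of_injective _ (algebraMap F K).injective
  have hQ : rename e P ≠ 0 := fun h =>
    hP (rename_injective e e.injective (by rw [h, map_zero]))
  have h := schwartz_zippel_totalDegree hQ S
  have hdeg := totalDegree_rename_le e P
  rw [hS] at h
  set Z := {f ∈ Fintype.piFinset fun _ : Fin (Fintype.card σ) => S | eval f (rename e P) = 0}
  have hcard : {x : σ → F | eval (algebraMap F K ∘ x) P = 0}.ncard ≤ Z.card := by
    rw [← Set.ncard_coe_finset]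
    refine Set.ncard_le_ncard_of_injOn (fun x => algebraMap F K ∘ x ∘ e.symm) (fun x hx => ?_)
      (fun x _ y _ hxy => ?_)
    · simp only [Z, Finset.coe_filter, Set.mem_ofPred_eq, Fintype.mem_piFinset, eval_rename] at hx ⊢
      refine ⟨fun i => Finset.mem_image_of_mem _ (Finset.mem_univ _), ?_⟩
      have hxe : (algebraMap F K ∘ x ∘ e.symm) ∘ e = algebraMap F K ∘ x := by
        ext s
        simp
      rwa [hxe]
    · exact e.symm.surjective.injective_comp_right ((algebraMap F K).injective.comp_left hxy)
  have hq : (0 : ℚ≥0) < Fintype.card F := by exact_mod_cast Fintype.card_pos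
  rw [div_le_div_iff₀ (pow_pos hq _) hq] at h
  have h' : Z.card * Fintype.card F ≤
      (rename e P).totalDegree * Fintype.card F ^ Fintype.card σ := by exact_mod_cast h
  calc _ ≤ Fintype.card F * Z.card := Nat.mul_le_mul_left _ hcard
    _ ≤ _ := by rw [mul_comm]; exact h'.trans (Nat.mul_le_mul_right _ hdeg)

/-- Kaltofen–Saunders: for an `n × n` matrix `A` of rank `< n` over a finite field with `q`
elements, the set of bad triples `(u, v, d)` with `u_1 = v_1 = 1` — those for which
`rank A ≠ deg (minpoly (U(u)·A·V(v)·D_d)) - 1` — has cardinality at most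
`(n(3n+1)/(2q)) · q^{3n-2}`, i.e. `2q · |Bad| ≤ n(3n+1) · q^{3n-2}`. -/
theorem stmt10 (F : Type*) [Field F] [Fintype F] [DecidableEq F]
    (q : ℕ) (hq : q = Fintype.card F)
    (n : ℕ) (hn : 1 ≤ n) (A : Matrix (Fin n) (Fin n) F) (hA : A.rank < n) :
    2 * q * Set.ncard {uvd : (Fin n → F) × (Fin n → F) × (Fin n → F) |
        uvd.1 ⟨0, hn⟩ = 1 ∧ uvd.2.1 ⟨0, hn⟩ = 1 ∧
          A.rank ≠ (minpoly F
            (upperToeplitz uvd.1 * A * lowerToeplitz uvd.2.1 *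
              Matrix.diagonal uvd.2.2)).natDegree - 1}
      ≤ n * (3 * n + 1) * q ^ (3 * n - 2) := by
  obtain ⟨m, rfl⟩ : ∃ m, n = m + 1 := ⟨n - 1, by omega⟩
  obtain ⟨P, hP, hdeg, hbad⟩ :=
    exists_polynomial_of_rank_ne_natDegree_minpoly (K := AlgebraicClosure F) A hA
  have hzeros := card_mul_ncard_zeros_le (F := F) hP
  have hσ : Fintype.card (Fin m ⊕ Fin m ⊕ Fin (m + 1)) = 3 * (m + 1) - 2 := by
    simp only [Fintype.card_sum, Fintype.card_fin]
    omega
  rw [hσ, ← hq] at hzeros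
  have htail : ∀ u : Fin (m + 1) → F, u 0 = 1 → Fin.cons 1 (Fin.tail u) = u := by
    intro u hu
    rw [← hu, Fin.cons_self_tail]
  refine (Nat.mul_le_mul_left (2 * q) (Set.ncard_le_ncard_of_injOn
    (t := {x : Fin m ⊕ Fin m ⊕ Fin (m + 1) → F |
      MvPolynomial.eval (algebraMap F (AlgebraicClosure F) ∘ x) P = 0})
    (fun uvd => Sum.elim (Fin.tail uvd.1) (Sum.elim (Fin.tail uvd.2.1) uvd.2.2)) ?_ ?_)).trans ?_
  · rintro ⟨u, v, d⟩ ⟨hu, hv, hne⟩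
    refine hbad _ ?_
    rw [toeplitzPrecondition]
    simp only [Sum.elim_comp_inl, ← Function.comp_assoc, Sum.elim_comp_inr]
    rwa [htail u hu, htail v hv]
  · rintro ⟨u, v, d⟩ ⟨hu, hv, -⟩ ⟨u', v', d'⟩ ⟨hu', hv', -⟩ h
    obtain ⟨h1, h2⟩ := Sum.elim_eq_iff.1 h
    obtain ⟨h3, h4⟩ := Sum.elim_eq_iff.1 h2
    simp only at h1 h3 h4
    rw [← htail u hu, ← htail v hv, ← htail u' hu', ← htail v' hv', h1, h3, h4]
  · have hr : A.rank * (A.rank + 1) ≤ (m + 1) * (m + 1) :=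
      Nat.mul_le_mul hA.le hA
    calc 2 * q * _ = 2 * (q * _) := mul_assoc _ _ _
      _ ≤ 2 * (P.totalDegree * q ^ (3 * (m + 1) - 2)) := Nat.mul_le_mul_left 2 hzeros
      _ = 2 * P.totalDegree * q ^ (3 * (m + 1) - 2) := (mul_assoc _ _ _).symm
      _ ≤ _ := Nat.mul_le_mul_right _ (hdeg.trans (by nlinarith))
end
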